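/- Let φ be a Jacob's ladder with parameters T⁰, c₀, C, and set h = 6.6×10⁻²⁷. Then there exist a sufficiently large ν₀ ∈ ℕ and a strictly increasing sequence (T̂_ν)_{ν≥ν₀} tending to infinity such that π·∫_{T̂_ν}^{T̂_{ν+1}} |ζ(1/2+it)|² dt = h for every ν ≥ ν₀. -/

import Mathlib

open Real MeasureTheory Filter

/-- `Z²(t) = |ζ(1/2 + it)|²`, the square of the modulus of Hardy's Z-function. -/
noncomputable def Z2 (t : ℝ) : ℝ := ‖riemannZeta (1/2 + t * Complex.I)‖ ^ 2

/-- The Hardy–Littlewood integral `I(T) = ∫₀^T |ζ(1/2+it)|² dt`. -/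
noncomputable def HL (T : ℝ) : ℝ := ∫ t in (0:ℝ)..T, Z2 t

/-- `F(y) = (y/2)·ln(y/2) + (γ − ln 2π)·(y/2) + c₀`. -/
noncomputable def F (c₀ y : ℝ) : ℝ :=
  y / 2 * Real.log (y / 2)
    + (Real.eulerMascheroniConstant - Real.log (2 * Real.pi)) * (y / 2) + c₀

/-- A Jacob's ladder with parameters `T⁰, c₀, C`. -/
structure JacobsLadder (φ : ℝ → ℝ) (T0 c₀ C : ℝ) : Prop where
  one_lt : 1 < T0
  contOn : ContinuousOn φ (Set.Ici T0)
  strictMonoOn : StrictMonoOn φ (Set.Ici T0)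
  lower : ∀ T, T0 ≤ T → 1.9 * T < φ T
  upper : ∀ T, T0 ≤ T → φ T < 2 * T
  approx : ∀ T, T0 ≤ T → |HL T - F c₀ (φ T)| ≤ C * Real.log T / T

/-- `a = ln 2π − 1 − γ`. -/
noncomputable def aConst : ℝ := Real.log (2 * Real.pi) - 1 - Real.eulerMascheroniConstant

lemma Z2_cont : Continuous Z2 := by
  unfold Z2
  rw [continuous_iff_continuousAt]
  intro t
  have h1 : (1/2 + (t:ℂ) * Complex.I) ≠ 1 := by
    intro h
    have := congrArg Complex.re h
    norm_num at this
  have h2 : ContinuousAt riemannZeta (1/2 + (t:ℂ) * Complex.I) :=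
    (differentiableAt_riemannZeta h1).continuousAt
  have h3 : ContinuousAt (fun t : ℝ => (1/2 + (t:ℂ) * Complex.I)) t := by fun_prop
  exact (ContinuousAt.comp (f := fun t : ℝ => (1/2 + (t:ℂ) * Complex.I)) h2 h3).norm.pow 2

lemma Z2_int (a b : ℝ) : IntervalIntegrable Z2 volume a b := Z2_cont.intervalIntegrable a b

lemma HL_sub (a b : ℝ) : HL b - HL a = ∫ t in a..b, Z2 t :=
  intervalIntegral.integral_interval_sub_left (Z2_int _ _) (Z2_int _ _)

lemma HL_mono : Monotone HL := by
  intro a b hab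
  have h : 0 ≤ ∫ t in a..b, Z2 t :=
    intervalIntegral.integral_nonneg hab (fun t _ => by unfold Z2; positivity)
  rw [← HL_sub] at h
  linarith

lemma HL_cont : Continuous HL :=
  intervalIntegral.continuous_primitive Z2_int 0

lemma F_tendsto (c₀ : ℝ) : Tendsto (F c₀) atTop atTop := by
  have h1 : Tendsto (fun y : ℝ => y / 2) atTop atTop := tendsto_id.atTop_div_const (by norm_num)
  have h2 : Tendsto (fun y : ℝ => Real.log (y/2) +
      (Real.eulerMascheroniConstant - Real.log (2 * Real.pi))) atTop atTop :=
    tendsto_atTop_add_const_right _ _ (Real.tendsto_log_atTop.comp h1)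
  have h3 := tendsto_atTop_add_const_right _ c₀ (h1.atTop_mul_atTop₀ h2)
  refine h3.congr (fun y => ?_)
  unfold F
  ring

lemma HL_tendsto {φ : ℝ → ℝ} {T0 c₀ C : ℝ} (hφ : JacobsLadder φ T0 c₀ C) :
    Tendsto HL atTop atTop := by
  have hp : Tendsto φ atTop atTop := by
    refine tendsto_atTop_mono' _ ?_ (tendsto_id (α := ℝ))
    filter_upwards [eventually_ge_atTop T0] with T hT
    have := hφ.lower T hT
    have := hφ.one_lt
    simp only [id]
    linarith
  have hF := (F_tendsto c₀).comp hp
  refine tendsto_atTop_mono' _ ?_ (tendsto_atTop_add_const_right _ (-|C|) hF)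
  filter_upwards [eventually_ge_atTop T0] with T hT
  have h1 := hφ.one_lt
  have h2 := (abs_le.mp (hφ.approx T hT)).1
  have h3 : C * Real.log T / T ≤ |C| := by
    rw [div_le_iff₀ (by linarith)]
    have hl : 0 ≤ Real.log T := Real.log_nonneg (by linarith)
    have hl2 : Real.log T ≤ T := Real.log_le_self (by linarith)
    exact mul_le_mul (le_abs_self C) hl2 hl (abs_nonneg C)
  simp only [Function.comp]
  linarith

/-- for a Jacob's ladder `φ` and `h = 6.6×10⁻²⁷` (the Planck quantum) there
are `ν₀` and a strictly increasing sequence `(T̂_ν)_{ν ≥ ν₀}` tending to infinity with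
`π·∫_{T̂_ν}^{T̂_{ν+1}} |ζ(1/2+it)|² dt = h` for every `ν ≥ ν₀`. -/
theorem planck_quantization (φ : ℝ → ℝ) (T0 c₀ C : ℝ) (hφ : JacobsLadder φ T0 c₀ C) :
    ∃ ν₀ : ℕ, ∃ T : ℕ → ℝ,
      (∀ μ ν, ν₀ ≤ μ → μ < ν → T μ < T ν) ∧
      Tendsto T atTop atTop ∧
      (∀ ν, ν₀ ≤ ν →
        Real.pi * ∫ t in (T ν)..(T (ν + 1)), Z2 t = 6.6e-27) := by
  have hlim := HL_tendsto hφ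
  have hex : ∀ n : ℕ, ∃ t : ℝ, HL t = n * (6.6e-27 / Real.pi) := by
    intro n
    have h0 : HL 0 = 0 := by simp [HL]
    obtain ⟨M, hM⟩ := (hlim.eventually_ge_atTop ((n:ℝ) * (6.6e-27 / Real.pi))).exists
    exact mem_range_of_exists_le_of_exists_ge HL_cont
      ⟨0, by rw [h0]; positivity⟩ ⟨M, hM⟩
  choose T hT using hex
  have hpos : (0:ℝ) < 6.6e-27 / Real.pi := by positivity
  refine ⟨0, T, ?_, ?_, ?_⟩
  · intro μ ν _ h
    apply HL_mono.reflect_lt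
    rw [hT, hT]
    have : (μ:ℝ) < ν := by exact_mod_cast h
    exact mul_lt_mul_of_pos_right this hpos
  · rw [tendsto_atTop]
    intro M
    have h1 : Tendsto (fun n : ℕ => (n:ℝ) * (6.6e-27 / Real.pi)) atTop atTop :=
      tendsto_natCast_atTop_atTop.atTop_mul_const hpos
    filter_upwards [h1.eventually_gt_atTop (HL M)] with n hn
    rw [← hT] at hn
    exact (HL_mono.reflect_lt hn).le
  · intro ν _
    rw [← HL_sub, hT, hT]
    push_cast
    have := Real.pi_ne_zero
    field_simp
    ring
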